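/- Let A be a matrix of closed 1-forms on a manifold X, strictly block-upper-triangular for a decomposition n = r₁ + ⋯ + r_{s+1}, satisfying A ∧ A = 0. Then for each 1 ≤ t ≤ s−1 the bar-complex element B_t := Σ_{1 < i₁ < ⋯ < i_t < s+1} [ω_{1,i₁} | ω_{i₁,i₂} | … | ω_{i_t, s+1}] (where ω_{ij} are the entries/blocks of A) satisfies d_I(B_t) = 0 and d_C(B_t) = 0. -/

import Mathlib

open scoped Classical

theorem Fin.insertNth_succ_castSucc_apply_castSucc {α : Type*} {t : ℕ} (j : Fin t) (x : α)
    (g : Fin (t + 1) → α) (i : Fin (t + 1)) (hi : (i : ℕ) ≤ j) :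
    j.castSucc.succ.insertNth (α := fun _ => α) x g i.castSucc = g i := by
  have h : i.castSucc = j.castSucc.succ.succAbove i := by
    rw [Fin.succAbove_of_castSucc_lt]
    simp only [Fin.lt_def, Fin.val_castSucc, Fin.val_succ]
    omega
  rw [h, Fin.insertNth_apply_succAbove]

theorem Fin.insertNth_succ_castSucc_apply_succ {α : Type*} {t : ℕ} (j : Fin t) (x : α)
    (g : Fin (t + 1) → α) (i : Fin (t + 1)) (hi : (j : ℕ) < i) :
    j.castSucc.succ.insertNth (α := fun _ => α) x g i.succ = g i := by
  have h : i.succ = j.castSucc.succ.succAbove i := by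
    rw [Fin.succAbove_of_le_castSucc]
    simp only [Fin.le_def, Fin.val_castSucc, Fin.val_succ]
    omega
  rw [h, Fin.insertNth_apply_succAbove]

/-- A strictly triangular matrix has vanishing brackets along chains that are not increasing. -/
theorem TensorAlgebra.ofFn_prod_eq_zero_of_not_strictMono {R B : Type*} [CommRing R] [Ring B]
    [Algebra R B] {n m : ℕ} (ω : Fin m → Fin m → B) (htri : ∀ i j, j ≤ i → ω i j = 0)
    (c : Fin (n + 1) → Fin m) (hc : ¬ StrictMono c) :
    (List.ofFn fun k : Fin n => TensorAlgebra.ι R (ω (c k.castSucc) (c k.succ))).prod = 0 := by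
  rw [Fin.strictMono_iff_lt_succ] at hc
  push Not at hc
  obtain ⟨k, hk⟩ := hc
  rw [← TensorAlgebra.tprod_apply]
  exact MultilinearMap.map_coord_zero _ k (htri _ _ hk)

/-- Contracting the `j`-th pair of consecutive entries, the sum over the chains with prescribed
end points vanishes when `ω` squares to zero. -/
theorem TensorAlgebra.sum_contract_eq_zero {R B α : Type*} [CommRing R] [Ring B] [Algebra R B]
    [Fintype α] {t : ℕ} (ω : α → α → B) (hωω : ∀ i j, ∑ k, ω i k * ω k j = 0)
    (a b : α) (r : R) (j : Fin t) :
    ∑ c : Fin (t + 2) → α, (if c 0 = a ∧ c (Fin.last (t + 1)) = b then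
      (List.ofFn fun k : Fin t => TensorAlgebra.ι R
        (if (k : ℕ) < (j : ℕ) then r • ω (c k.castSucc.castSucc) (c k.castSucc.succ)
          else if k = j then
            (r • ω (c j.castSucc.castSucc) (c j.castSucc.succ)) *
              ω (c j.succ.castSucc) (c j.succ.succ)
          else ω (c k.succ.castSucc) (c k.succ.succ))).prod else 0) = 0 := by
  rw [← (Fin.insertNthEquiv (fun _ => α) j.castSucc.succ).sum_comp, Fintype.sum_prod_type_right]
  refine Finset.sum_eq_zero fun g _ => ?_
  have h0 : ∀ x, j.castSucc.succ.insertNth (α := fun _ => α) x g 0 = g 0 := fun x =>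
    Fin.insertNth_succ_castSucc_apply_castSucc j x g 0 (Nat.zero_le _)
  have hlast : ∀ x, j.castSucc.succ.insertNth (α := fun _ => α) x g (Fin.last (t + 1)) =
      g (Fin.last t) := fun x =>
    Fin.insertNth_succ_castSucc_apply_succ j x g (Fin.last t) j.isLt
  simp only [Fin.insertNthEquiv_apply, h0, hlast]
  by_cases hg : g 0 = a ∧ g (Fin.last t) = b
  swap
  · simp [hg]
  simp only [if_pos hg, ← TensorAlgebra.tprod_apply]
  let v : Fin t → B := fun k =>
    if (k : ℕ) < (j : ℕ) then r • ω (g k.castSucc) (g k.succ) else ω (g k.castSucc) (g k.succ)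
  have hv : ∀ x, (fun k : Fin t =>
      let c : Fin (t + 2) → α := j.castSucc.succ.insertNth (α := fun _ => α) x g
      if (k : ℕ) < (j : ℕ) then r • ω (c k.castSucc.castSucc) (c k.castSucc.succ)
        else if k = j then
          (r • ω (c j.castSucc.castSucc) (c j.castSucc.succ)) *
            ω (c j.succ.castSucc) (c j.succ.succ)
        else ω (c k.succ.castSucc) (c k.succ.succ)) =
      Function.update v j (r • (ω (g j.castSucc) x * ω x (g j.succ))) := by
    intro x
    funext k
    rcases lt_trichotomy (k : ℕ) (j : ℕ) with hk | hk | hk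
    · have hne : k ≠ j := fun h => by simp [h] at hk
      have h1 := Fin.insertNth_succ_castSucc_apply_castSucc j x g k.castSucc (by simpa using hk.le)
      have h2 := Fin.insertNth_succ_castSucc_apply_castSucc j x g k.succ (by simpa using hk)
      rw [← Fin.succ_castSucc] at h2
      simp [Fin.lt_def.2 hk, hne, v, h1, h2]
    · obtain rfl : k = j := Fin.ext hk
      have h1 := Fin.insertNth_succ_castSucc_apply_castSucc k x g k.castSucc (by simp)
      have h2 := Fin.insertNth_succ_castSucc_apply_succ k x g k.succ (by simp)
      have h3 : k.castSucc.succ.insertNth (α := fun _ => α) x g k.castSucc.succ = x :=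
        Fin.insertNth_apply_same _ _ _
      simp [h1, h2, h3, -Fin.insertNth_apply_same]
    · have hne : k ≠ j := fun h => by simp [h] at hk
      have h1 := Fin.insertNth_succ_castSucc_apply_succ j x g k.castSucc (by simpa using hk)
      have h2 := Fin.insertNth_succ_castSucc_apply_succ j x g k.succ (by simp; omega)
      simp [(Fin.lt_def.2 hk).not_gt, hne, v, h1, h2]
  simp only at hv
  simp only [hv]
  rw [← MultilinearMap.map_update_sum, ← Finset.smul_sum, hωω, smul_zero,
    MultilinearMap.map_update_zero]

/-- Lemma 6.2 computation: for a strictly block-upper-triangular matrix `A = (ω_{ij})`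
of closed 1-forms with `A ∧ A = 0`, the bar-complex element
`B_t = Σ_{0 < i₁ < ⋯ < i_t < s+1} [ω_{0,i₁}|ω_{i₁,i₂}|…|ω_{i_t,s+1}]`
satisfies `d_I(B_t) = 0` and `d_C(B_t) = 0`.

Here `B` is a graded dg-algebra (the forms) with grading `𝒜` and differential `d`,
brackets `[ω₁|…|ω_r]` are modelled as products `ι(ω₁)⋯ι(ω_r)` in the tensor algebra,
and `dC`, `dI` are linear maps satisfying Chen's formulas on such brackets of
homogeneous elements (with `Jω = (−1)^{deg ω} ω`); the sum defining `B_t` runs over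
strictly increasing chains `c : Fin (t+2) → Fin (s+2)` from `0` to `s+1`. -/
theorem bar_element_of_flat_triangular_matrix_is_closed
    {B : Type*} [Ring B] [Algebra ℂ B]
    (𝒜 : ℕ → Submodule ℂ B) (d : B →ₗ[ℂ] B)
    (dC dI : TensorAlgebra ℂ B →ₗ[ℂ] TensorAlgebra ℂ B)
    (hdC : ∀ (r : ℕ) (deg : Fin (r + 1) → ℕ) (η : Fin (r + 1) → B),
      (∀ i, 1 ≤ deg i) → (∀ i, η i ∈ 𝒜 (deg i)) →
      dC ((List.ofFn fun i => TensorAlgebra.ι ℂ (η i)).prod) =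
        ∑ j : Fin r, ((-1 : ℂ) ^ (j : ℕ)) •
          ((List.ofFn fun k : Fin r =>
            TensorAlgebra.ι ℂ
              (if (k : ℕ) < (j : ℕ) then ((-1 : ℂ) ^ deg k.castSucc) • η k.castSucc
               else if k = j then
                 (((-1 : ℂ) ^ deg j.castSucc) • η j.castSucc) * η j.succ
               else η k.succ)).prod))
    (hdI : ∀ (r : ℕ) (deg : Fin r → ℕ) (η : Fin r → B),
      (∀ i, 1 ≤ deg i) → (∀ i, η i ∈ 𝒜 (deg i)) →
      dI ((List.ofFn fun i => TensorAlgebra.ι ℂ (η i)).prod) =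
        ∑ j : Fin r, ((-1 : ℂ) ^ ((j : ℕ) + 1)) •
          ((List.ofFn fun k : Fin r =>
            TensorAlgebra.ι ℂ
              (if (k : ℕ) < (j : ℕ) then ((-1 : ℂ) ^ deg k) • η k
               else if k = j then d (η k)
               else η k)).prod))
    (s t : ℕ) (ht1 : 1 ≤ t) (ht2 : t + 1 ≤ s)
    (ω : Fin (s + 2) → Fin (s + 2) → B)
    (hω1 : ∀ i j, ω i j ∈ 𝒜 1)
    (hclosed : ∀ i j, d (ω i j) = 0)
    (htri : ∀ i j, j ≤ i → ω i j = 0)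
    (hAA : ∀ i j, ∑ k, ω i k * ω k j = 0) :
    dI (∑ c : Fin (t + 2) → Fin (s + 2),
          if (∀ i j, i < j → c i < c j) ∧ c 0 = 0 ∧ c (Fin.last (t + 1)) = Fin.last (s + 1)
          then (List.ofFn fun k : Fin (t + 1) =>
                  TensorAlgebra.ι ℂ (ω (c k.castSucc) (c k.succ))).prod
          else 0) = 0 ∧
    dC (∑ c : Fin (t + 2) → Fin (s + 2),
          if (∀ i j, i < j → c i < c j) ∧ c 0 = 0 ∧ c (Fin.last (t + 1)) = Fin.last (s + 1)
          then (List.ofFn fun k : Fin (t + 1) =>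
                  TensorAlgebra.ι ℂ (ω (c k.castSucc) (c k.succ))).prod
          else 0) = 0 := by
  constructor
  · rw [map_sum]
    refine Finset.sum_eq_zero fun c _ => ?_
    split_ifs
    swap
    · exact map_zero _
    rw [hdI (t + 1) (fun _ => 1) (fun k => ω (c k.castSucc) (c k.succ)) (fun _ => le_rfl)
      (fun _ => hω1 _ _)]
    refine Finset.sum_eq_zero fun j _ => ?_
    rw [← TensorAlgebra.tprod_apply, MultilinearMap.map_coord_zero _ j (by simp [hclosed]),
      smul_zero]
  · have hstrict : ∀ c : Fin (t + 2) → Fin (s + 2),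
        (if (∀ i j, i < j → c i < c j) ∧ c 0 = 0 ∧ c (Fin.last (t + 1)) = Fin.last (s + 1)
          then (List.ofFn fun k : Fin (t + 1) =>
                  TensorAlgebra.ι ℂ (ω (c k.castSucc) (c k.succ))).prod
          else 0) =
        if c 0 = 0 ∧ c (Fin.last (t + 1)) = Fin.last (s + 1)
          then (List.ofFn fun k : Fin (t + 1) =>
                  TensorAlgebra.ι ℂ (ω (c k.castSucc) (c k.succ))).prod
          else 0 := by
      intro c
      by_cases hc : ∀ i j, i < j → c i < c j
      · exact if_congr (and_iff_right hc) rfl rfl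
      · rw [TensorAlgebra.ofFn_prod_eq_zero_of_not_strictMono ω htri c fun h => hc fun i j => @h i j,
          ite_self, ite_self]
    simp only [hstrict]
    have hterm := fun c : Fin (t + 2) → Fin (s + 2) =>
      hdC t (fun _ => 1) (fun k => ω (c k.castSucc) (c k.succ)) (fun _ => le_rfl)
        (fun _ => hω1 _ _)
    simp only [map_sum, apply_ite dC, map_zero, hterm]
    have hpush : ∀ (p : Prop) [Decidable p] (f : Fin t → TensorAlgebra ℂ B),
        (if p then ∑ j : Fin t, ((-1 : ℂ) ^ (j : ℕ)) • f j else 0) =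
          ∑ j : Fin t, ((-1 : ℂ) ^ (j : ℕ)) • (if p then f j else 0) := by
      intro p _ f
      split_ifs <;> simp
    simp only [hpush]
    rw [Finset.sum_comm]
    refine Finset.sum_eq_zero fun j _ => ?_
    rw [← Finset.smul_sum]
    convert smul_zero _ using 2
    convert TensorAlgebra.sum_contract_eq_zero ω hAA 0 (Fin.last (s + 1)) ((-1 : ℂ) ^ 1) j
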